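/- arXiv:2409.20254 — 2 statements merged into one kernel-verified Lean document; each statement's English description precedes it below -/
import Mathlib

section
/- Let q be a prime with q ≡ 1 (mod 6) or q = 3, and let s be an integer with q ∣ Φ₃(s), where Φ₃(x) = x² + x + 1. Then for every integer x, Φ₆(Φ₄(q·x + s)) = q · f₁(x) · f₂(x), where f₁(x) = q·x² + (2s + 1)·x + Φ₃(s)/q and f₂(x) = q²·x² + (2s − 1)·q·x + Φ₆(s), with Φ₄(x) = x² + 1 and Φ₆(x) = x² − x + 1. Moreover f₁ and f₂ are irreducible as polynomials over ℤ. -/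
open Polynomial

/-- The 3rd cyclotomic polynomial, evaluated at an integer. -/
def Phi3 (x : ℤ) : ℤ := x ^ 2 + x + 1

/-- The 4th cyclotomic polynomial, evaluated at an integer. -/
def Phi4 (x : ℤ) : ℤ := x ^ 2 + 1

/-- The 6th cyclotomic polynomial, evaluated at an integer. -/
def Phi6 (x : ℤ) : ℤ := x ^ 2 - x + 1

/-- A primitive integer quadratic with negative discriminant is irreducible. -/
theorem irreducible_quadratic_of_discrim_neg {a b c : ℤ} (hdisc : discrim a b c < 0)
    (hprim : ∀ d : ℤ, d ∣ a → d ∣ b → d ∣ c → IsUnit d) :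
    Irreducible (C a * X ^ 2 + C b * X + C c : ℤ[X]) := by
  have ha : a ≠ 0 := by
    rintro rfl
    simp only [discrim] at hdisc
    nlinarith [sq_nonneg b]
  have hdeg := natDegree_quadratic (b := b) (c := c) ha
  have isUnit_of_natDegree_eq_zero : ∀ g h : ℤ[X],
      C a * X ^ 2 + C b * X + C c = g * h → g.natDegree = 0 → IsUnit g := by
    intro g h hgh hg
    obtain ⟨d, rfl⟩ := natDegree_eq_zero.mp hg
    have hd := (C_dvd_iff_dvd_coeff d _).mp (Dvd.intro h hgh.symm)
    refine isUnit_C.mpr (hprim d ?_ ?_ ?_)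
    · simpa [coeff_X, coeff_C, -eq_intCast] using hd 2
    · simpa [coeff_X, coeff_C, -eq_intCast] using hd 1
    · simpa [coeff_X, coeff_C, -eq_intCast] using hd 0
  refine ⟨fun hu => ?_, fun g h hgh => ?_⟩
  · have := natDegree_eq_zero_of_isUnit hu
    omega
  · by_cases hg : g.natDegree = 0
    · exact Or.inl (isUnit_of_natDegree_eq_zero g h hgh hg)
    by_cases hh : h.natDegree = 0
    · exact Or.inr (isUnit_of_natDegree_eq_zero h g (hgh.trans (mul_comm g h)) hh)
    exfalso
    have hgh0 : g * h ≠ 0 := by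
      rw [← hgh]
      intro h0
      rw [h0, natDegree_zero] at hdeg
      omega
    rw [hgh, natDegree_mul (left_ne_zero_of_mul hgh0) (right_ne_zero_of_mul hgh0)] at hdeg
    obtain ⟨m, n, rfl⟩ := exists_eq_X_add_C_of_natDegree_le_one (p := g) (by omega)
    obtain ⟨k, l, rfl⟩ := exists_eq_X_add_C_of_natDegree_le_one (p := h) (by omega)
    have hmul : (C m * X + C n) * (C k * X + C l) =
        C (m * k) * X ^ 2 + C (m * l + n * k) * X + C (n * l) := by
      simp only [C_mul, C_add]
      ring
    rw [hmul] at hgh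
    have h2 : a = m * k := by
      simpa [coeff_X, coeff_C, -eq_intCast, -map_mul, -map_add] using congrArg (coeff · 2) hgh
    have h1 : b = m * l + n * k := by
      simpa [coeff_X, coeff_C, -eq_intCast, -map_mul, -map_add] using congrArg (coeff · 1) hgh
    have h0 : c = n * l := by
      simpa [coeff_X, coeff_C, -eq_intCast, -map_mul, -map_add] using congrArg (coeff · 0) hgh
    subst h2 h1 h0
    simp only [discrim] at hdisc
    nlinarith [sq_nonneg (m * l - n * k)]

/-- An odd prime dividing `Phi3 s` is coprime to `Phi6 s`. -/
theorem isCoprime_Phi6_of_dvd_Phi3 {q s : ℤ} (hq : Prime q) (hodd : Odd q) (hdvd : q ∣ Phi3 s) :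
    IsCoprime q (Phi6 s) := by
  refine hq.irreducible.coprime_iff_not_dvd.mpr fun h6 => ?_
  have h2s : q ∣ 2 * s := by
    have := dvd_sub hdvd h6
    rwa [show Phi3 s - Phi6 s = 2 * s by simp only [Phi3, Phi6]; ring] at this
  rcases hq.dvd_or_dvd h2s with h2 | hs
  · have hcop : IsCoprime q 2 := by
      obtain ⟨k, rfl⟩ := hodd
      exact ⟨1, -k, by ring⟩
    exact hq.not_isUnit (hcop.isUnit_of_dvd' dvd_rfl h2)
  · have h1 : q ∣ 1 := by
      have := dvd_sub hdvd (hs.mul_right (s + 1))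
      rwa [show Phi3 s - s * (s + 1) = 1 by simp only [Phi3]; ring] at this
    exact hq.not_isUnit (isUnit_of_dvd_one h1)

theorem mnt_k6_case_phi3 (q : ℤ) (hq : Prime q) (hmod : q % 6 = 1 ∨ q = 3)
    (s : ℤ) (hdvd : q ∣ Phi3 s) :
    (∀ x : ℤ, Phi6 (Phi4 (q * x + s)) =
      q * (q * x ^ 2 + (2 * s + 1) * x + Phi3 s / q) *
        (q ^ 2 * x ^ 2 + (2 * s - 1) * q * x + Phi6 s)) ∧
    Irreducible (C q * X ^ 2 + C (2 * s + 1) * X + C (Phi3 s / q)) ∧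
    Irreducible (C (q ^ 2) * X ^ 2 + C ((2 * s - 1) * q) * X + C (Phi6 s)) := by
  have hodd : Odd q := by
    rw [Int.odd_iff]
    omega
  have hcop := isCoprime_Phi6_of_dvd_Phi3 hq hodd hdvd
  obtain ⟨t, ht⟩ := hdvd
  rw [ht, Int.mul_ediv_cancel_left t hq.ne_zero]
  simp only [Phi3] at ht
  refine ⟨fun x => ?_, ?_, ?_⟩
  · simp only [Phi4, Phi6]
    linear_combination (q ^ 2 * x ^ 2 + (2 * s - 1) * q * x + (s ^ 2 - s + 1)) * ht
  · have hdisc : discrim q (2 * s + 1) t = -3 := by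
      simp only [discrim]
      linear_combination 4 * ht
    refine irreducible_quadratic_of_discrim_neg (by omega) fun d hdq hdb hdt => ?_
    have hd3 : d * d ∣ 3 := by
      have := dvd_sub ((mul_dvd_mul hdq hdt).mul_left 4) (mul_dvd_mul hdb hdb)
      rwa [show 4 * (q * t) - (2 * s + 1) * (2 * s + 1) = 3 by
        linear_combination -4 * ht] at this
    exact Int.prime_three.squarefree d hd3
  · refine irreducible_quadratic_of_discrim_neg ?_ fun d hdq _ hdc =>
      (hcop.pow_left (m := 2)).isUnit_of_dvd' hdq hdc
    have hdisc : discrim (q ^ 2) ((2 * s - 1) * q) (Phi6 s) = -3 * q ^ 2 := by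
      simp only [discrim, Phi6]
      ring
    have := sq_pos_of_ne_zero hq.ne_zero
    omega
end

section
/- Let g₀(x) = 3x² − 1, g₁(x) = 3x² − 3x + 1, g₂(x) = 3x² + 3x + 1. Let q be a prime with q ≡ 1 (mod 6), and let s be an integer with q ∣ g₁(s). Then for every integer x, Φ₃(g₀(q·x + s)) = q · f₉(x) · f₁₀(x), where f₉(x) = 3q·x² + (6s − 3)·x + g₁(s)/q and f₁₀(x) = 3q²·x² + (6s + 3)·q·x + g₂(s), with Φ₃(x) = x² + x + 1. Moreover f₉ and f₁₀ are irreducible as polynomials over ℤ. -/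
open Polynomial

def g0 (x : ℤ) : ℤ := 3 * x ^ 2 - 1

def g1 (x : ℤ) : ℤ := 3 * x ^ 2 - 3 * x + 1

def g2 (x : ℤ) : ℤ := 3 * x ^ 2 + 3 * x + 1

theorem quadratic_irreducible_of_discrim_neg {a b c : ℤ} (hdisc : b ^ 2 - 4 * a * c < 0)
    (hprim : ∀ d : ℤ, d ∣ a → d ∣ b → d ∣ c → IsUnit d) :
    Irreducible (C a * X ^ 2 + C b * X + C c) := by
  have ha : a ≠ 0 := by
    rintro rfl
    nlinarith [sq_nonneg b]
  have hdeg := natDegree_quadratic (b := b) (c := c) ha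
  have isUnit_of_const : ∀ u v : ℤ[X], C a * X ^ 2 + C b * X + C c = u * v →
      u.natDegree = 0 → IsUnit u := by
    intro u v huv hu
    obtain ⟨d, rfl⟩ := natDegree_eq_zero.1 hu
    have hd := C_dvd_iff_dvd_coeff d _ |>.1 (Dvd.intro v huv.symm)
    refine isUnit_C.2 (hprim d ?_ ?_ ?_)
    · simpa [coeff_X, coeff_C, -eq_intCast] using hd 2
    · simpa [coeff_X, coeff_C, -eq_intCast] using hd 1
    · simpa [coeff_X, coeff_C, -eq_intCast] using hd 0
  refine ⟨fun h ↦ ?_, fun u v huv ↦ ?_⟩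
  · have := natDegree_eq_zero_of_isUnit h
    omega
  have hsum : u.natDegree + v.natDegree = 2 := by
    rw [← hdeg, huv, natDegree_mul]
    · rintro rfl
      simp [huv, -eq_intCast] at hdeg
    · rintro rfl
      simp [huv, -eq_intCast] at hdeg
  by_cases hu : u.natDegree = 0
  · exact Or.inl (isUnit_of_const u v huv hu)
  by_cases hv : v.natDegree = 0
  · exact Or.inr (isUnit_of_const v u (huv.trans (mul_comm u v)) hv)
  exfalso
  obtain ⟨u₁, u₀, rfl⟩ := exists_eq_X_add_C_of_natDegree_le_one (p := u) (by omega)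
  obtain ⟨v₁, v₀, rfl⟩ := exists_eq_X_add_C_of_natDegree_le_one (p := v) (by omega)
  have hmul : (C u₁ * X + C u₀) * (C v₁ * X + C v₀) =
      C (u₁ * v₁) * X ^ 2 + C (u₁ * v₀ + u₀ * v₁) * X + C (u₀ * v₀) := by
    simp only [C_mul, C_add]
    ring
  rw [hmul] at huv
  have h2 : a = u₁ * v₁ := by
    simpa [coeff_X, coeff_C, -eq_intCast, -map_mul] using congrArg (coeff · 2) huv
  have h1 : b = u₁ * v₀ + u₀ * v₁ := by
    simpa [coeff_X, coeff_C, -eq_intCast, -map_mul] using congrArg (coeff · 1) huv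
  have h0 : c = u₀ * v₀ := by
    simpa [coeff_X, coeff_C, -eq_intCast, -map_mul] using congrArg (coeff · 0) huv
  subst h2 h1 h0
  nlinarith [sq_nonneg (u₁ * v₀ - u₀ * v₁)]

theorem mnt_k3_case_g1 (q : ℤ) (hq : Prime q) (hmod : q % 6 = 1)
    (s : ℤ) (hdvd : q ∣ g1 s) :
    (∀ x : ℤ, Phi3 (g0 (q * x + s)) =
      q * (3 * q * x ^ 2 + (6 * s - 3) * x + g1 s / q) *
        (3 * q ^ 2 * x ^ 2 + (6 * s + 3) * q * x + g2 s)) ∧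
    Irreducible (C (3 * q) * X ^ 2 + C (6 * s - 3) * X + C (g1 s / q)) ∧
    Irreducible (C (3 * q ^ 2) * X ^ 2 + C ((6 * s + 3) * q) * X + C (g2 s)) := by
  have hq0 : q ≠ 0 := hq.ne_zero
  have hg1 : 3 * s ^ 2 - 3 * s + 1 = q * (g1 s / q) := (Int.mul_ediv_cancel' hdvd).symm
  generalize g1 s / q = m at hg1 ⊢
  refine ⟨fun x ↦ ?_, quadratic_irreducible_of_discrim_neg ?_ ?_,
    quadratic_irreducible_of_discrim_neg ?_ ?_⟩
  · have h1 : q * (3 * q * x ^ 2 + (6 * s - 3) * x + m) = g1 (q * x + s) := by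
      unfold g1
      linear_combination -hg1
    rw [h1]
    unfold Phi3 g0 g1 g2
    ring
  · have : (6 * s - 3) ^ 2 - 4 * (3 * q) * m = -3 := by linear_combination 12 * hg1
    omega
  · rintro d - ⟨k, hk⟩ ⟨l, rfl⟩
    refine isUnit_of_dvd_one ⟨4 * (q * l) - (2 * s - 1) * k, ?_⟩
    linear_combination 4 * hg1 - (2 * s - 1) * hk
  · have : ((6 * s + 3) * q) ^ 2 - 4 * (3 * q ^ 2) * g2 s = -3 * q ^ 2 := by
      unfold g2
      ring
    have := pow_pos (abs_pos.2 hq0) 2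
    rw [sq_abs] at this
    omega
  · intro d hd3 _ hd
    have hcop3 : IsCoprime d 3 := by
      obtain ⟨k, hk⟩ := hd
      exact ⟨k, -(s ^ 2 + s), by unfold g2 at hk; linear_combination -hk⟩
    have hcopq : IsCoprime d q := by
      refine ((Irreducible.coprime_iff_not_dvd hq.irreducible).2 fun hqd ↦ ?_).symm
      obtain ⟨k, hk⟩ := hqd.trans hd
      unfold g2 at hk
      refine hq.not_dvd_one ⟨1 - (q / 6) * (6 * m - 3 * (s - 1) * (k - m)), ?_⟩
      have hj : q = 6 * (q / 6) + 1 := by omega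
      have h2 : 2 = q * (2 * m - (s - 1) * (k - m)) := by
        linear_combination 2 * hg1 - (s - 1) * (hk - hg1)
      linear_combination -3 * (q / 6) * h2 - hj
    exact (hcop3.mul_right (hcopq.pow_right (n := 2))).isUnit_of_dvd' dvd_rfl hd3
end
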